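/- arXiv:1508.05403 — 6 statements merged into one kernel-verified Lean document; each statement's English description precedes it below -/
import Mathlib

section
/- Let Γ be a finite simple graph with vertex set S, let W_Γ be the associated right-angled Coxeter group, let a ∈ S, and let D be a nonempty subset of S \ St(a) which is a union of connected components of the induced subgraph of Γ on S \ St(a). Then there is a unique automorphism φ of W_Γ satisfying φ(s) = asa for all s ∈ D and φ(s) = s for all s ∈ S \ D; moreover φ ∘ φ is the identity and φ is not the identity. -/
open Classical in
/-- The Coxeter matrix of the right-angled Coxeter group `W_Γ` associated to a
finite simple graph `Γ`: diagonal entries are `1`, entries of adjacent pairs are `2`,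
and entries of distinct non-adjacent pairs are `0` (representing infinity). -/
noncomputable def racgMatrix {V : Type*} (Γ : SimpleGraph V) : CoxeterMatrix V where
  M := Matrix.of fun s t => if s = t then 1 else if Γ.Adj s t then 2 else 0
  isSymm := Matrix.IsSymm.ext fun s t => by
    by_cases h : s = t
    · subst h; rfl
    · simp [h, Ne.symm h, Γ.adj_comm]
  diagonal i := by simp
  off_diagonal i j h := by
    simp only [Matrix.of_apply, if_neg h]
    split <;> simp

/-- The star of a vertex `a`: the vertex `a` together with its neighbours. -/
def graphStar {V : Type*} (Γ : SimpleGraph V) (a : V) : Set V :=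
  {s | s = a ∨ Γ.Adj a s}

namespace RACG

variable {V : Type*} {Γ : SimpleGraph V}

theorem isLiftable {G : Type*} [Monoid G] {f : V → G} (hsq : ∀ s, f s * f s = 1)
    (hcomm : ∀ s t, Γ.Adj s t → Commute (f s) (f t)) : (racgMatrix Γ).IsLiftable f := by
  classical
  intro s t
  change (f s * f t) ^ (if s = t then 1 else if Γ.Adj s t then 2 else 0) = 1
  split_ifs with h h'
  · subst h
    rw [pow_one, hsq]
  · rw [(hcomm s t h').mul_pow, pow_two, pow_two, hsq, hsq, one_mul]
  · exact pow_zero _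

theorem exists_lift {G : Type*} [Monoid G] {f : V → G} (hsq : ∀ s, f s * f s = 1)
    (hcomm : ∀ s t, Γ.Adj s t → Commute (f s) (f t)) :
    ∃ F : (racgMatrix Γ).Group →* G, ∀ s, F ((racgMatrix Γ).simple s) = f s :=
  ⟨(racgMatrix Γ).toCoxeterSystem.lift ⟨f, isLiftable hsq hcomm⟩,
    (racgMatrix Γ).toCoxeterSystem.lift_apply_simple (isLiftable hsq hcomm)⟩

theorem hom_ext {G : Type*} [Monoid G] {F F' : (racgMatrix Γ).Group →* G}
    (h : ∀ s, F ((racgMatrix Γ).simple s) = F' ((racgMatrix Γ).simple s)) : F = F' :=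
  (racgMatrix Γ).toCoxeterSystem.ext_simple h

theorem simple_mul_self (s : V) :
    (racgMatrix Γ).simple s * (racgMatrix Γ).simple s = 1 :=
  (racgMatrix Γ).toCoxeterSystem.simple_mul_simple_self s

theorem inv_simple (s : V) : ((racgMatrix Γ).simple s)⁻¹ = (racgMatrix Γ).simple s :=
  (racgMatrix Γ).toCoxeterSystem.inv_simple s

theorem simple_conj_conj (a : V) (x : (racgMatrix Γ).Group) :
    (racgMatrix Γ).simple a * ((racgMatrix Γ).simple a * x * (racgMatrix Γ).simple a) *
      (racgMatrix Γ).simple a = x := by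
  simp only [mul_assoc, simple_mul_self, mul_one]
  rw [← mul_assoc, simple_mul_self, one_mul]

theorem commute_simple {s t : V} (h : Γ.Adj s t) :
    Commute ((racgMatrix Γ).simple s) ((racgMatrix Γ).simple t) := by
  have hM : racgMatrix Γ s t = 2 := by
    classical
    change (if s = t then 1 else if Γ.Adj s t then 2 else 0) = 2
    rw [if_neg h.ne, if_pos h]
  have hpow : ((racgMatrix Γ).simple s * (racgMatrix Γ).simple t) ^ 2 = 1 := by
    rw [← hM]
    exact (racgMatrix Γ).toCoxeterSystem.simple_mul_simple_pow s t
  rw [pow_two, mul_eq_one_iff_eq_inv, mul_inv_rev, inv_simple, inv_simple] at hpow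
  exact hpow

theorem simple_conj_ne {a s : V} (hs : s ∉ graphStar Γ a) :
    (racgMatrix Γ).simple a * (racgMatrix Γ).simple s * (racgMatrix Γ).simple a ≠
      (racgMatrix Γ).simple s := by
  classical
  have hsa : s ≠ a := fun h => hs (Or.inl h)
  have hadj : ¬Γ.Adj a s := fun h => hs (Or.inr h)
  obtain ⟨F, hF⟩ := exists_lift (Γ := Γ)
    (f := fun t => if t = a then (Equiv.swap 0 1 : Equiv.Perm (Fin 3))
      else if t = s then Equiv.swap 1 2 else 1)
    (fun t => by split_ifs <;> simp)
    (fun t u h => by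
      split_ifs with h₁ h₂ h₃ h₄ h₅ h₆
      all_goals first
        | exact Commute.refl _
        | exact Commute.one_left _
        | exact Commute.one_right _
        | (subst_vars; exact absurd h hadj)
        | (subst_vars; exact absurd h.symm hadj))
  intro h
  have h' := congrArg F h
  simp only [map_mul, hF, if_true, if_neg hsa] at h'
  revert h'
  decide

theorem exists_partialConjugation_hom {a : V} {D : Set V} (hsub : D ⊆ (graphStar Γ a)ᶜ)
    (hadj : ∀ s t, s ∈ D → t ∉ graphStar Γ a → Γ.Adj s t → t ∈ D) :
    ∃ F : (racgMatrix Γ).Group →* (racgMatrix Γ).Group,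
      (∀ s ∈ D, F ((racgMatrix Γ).simple s) =
        (racgMatrix Γ).simple a * (racgMatrix Γ).simple s * (racgMatrix Γ).simple a) ∧
      (∀ s ∉ D, F ((racgMatrix Γ).simple s) = (racgMatrix Γ).simple s) := by
  classical
  have hmixed : ∀ s t, s ∈ D → t ∉ D → Γ.Adj s t →
      Commute ((racgMatrix Γ).simple a * (racgMatrix Γ).simple s * (racgMatrix Γ).simple a)
        ((racgMatrix Γ).simple t) := by
    intro s t hs ht h
    have hstar : t ∈ graphStar Γ a := by
      by_contra hn
      exact ht (hadj s t hs hn h)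
    have hat : Γ.Adj a t := by
      rcases hstar with rfl | hat
      · exact absurd (Or.inr h.symm) (hsub hs)
      · exact hat
    exact ((commute_simple hat).mul_left (commute_simple h)).mul_left (commute_simple hat)
  obtain ⟨F, hF⟩ := exists_lift (Γ := Γ)
    (f := fun s => if s ∈ D then
      (racgMatrix Γ).simple a * (racgMatrix Γ).simple s * (racgMatrix Γ).simple a
      else (racgMatrix Γ).simple s)
    (fun s => by
      split_ifs
      · have := conj_mul (a := (racgMatrix Γ).simple s) (b := (racgMatrix Γ).simple a)
          (c := (racgMatrix Γ).simple s)
        rwa [simple_mul_self, mul_one, mul_inv_cancel, inv_simple] at this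
      · exact simple_mul_self s)
    (fun s t h => by
      split_ifs with hs ht ht
      · have := (Commute.conj_iff ((racgMatrix Γ).simple a)).mpr (commute_simple h)
        rwa [inv_simple] at this
      · exact hmixed s t hs ht h
      · exact (hmixed t s ht hs h.symm).symm
      · exact commute_simple h)
  exact ⟨F, fun s hs => (hF s).trans (if_pos hs), fun s hs => (hF s).trans (if_neg hs)⟩

theorem partialConjugation_comp_self {a : V} {D : Set V} (ha : a ∉ D)
    {F : (racgMatrix Γ).Group →* (racgMatrix Γ).Group}
    (hD : ∀ s ∈ D, F ((racgMatrix Γ).simple s) =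
      (racgMatrix Γ).simple a * (racgMatrix Γ).simple s * (racgMatrix Γ).simple a)
    (hDc : ∀ s ∉ D, F ((racgMatrix Γ).simple s) = (racgMatrix Γ).simple s) :
    F.comp F = MonoidHom.id _ := by
  refine hom_ext fun s => ?_
  by_cases hs : s ∈ D
  · simp only [MonoidHom.comp_apply, MonoidHom.id_apply, hD s hs, map_mul, hDc a ha,
      simple_conj_conj]
  · simp only [MonoidHom.comp_apply, MonoidHom.id_apply, hDc s hs]

end RACG

/-- Existence, uniqueness, and basic properties of the partial conjugation with acting
letter `a` and domain `D`, where `D` is a nonempty union of connected components of the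
induced subgraph of `Γ` on the complement of the star of `a`. -/
theorem partialConjugation_exists_unique {V : Type*} [Fintype V] (Γ : SimpleGraph V)
    (a : V) (D : Set V) (hne : D.Nonempty) (hsub : D ⊆ (graphStar Γ a)ᶜ)
    (hcomp : ∀ (s t : V) (hs : s ∈ (graphStar Γ a)ᶜ) (ht : t ∈ (graphStar Γ a)ᶜ),
      s ∈ D → (Γ.induce ((graphStar Γ a)ᶜ : Set V)).Reachable ⟨s, hs⟩ ⟨t, ht⟩ → t ∈ D) :
    (∃! φ : MulAut (racgMatrix Γ).Group,
      (∀ s ∈ D, φ ((racgMatrix Γ).simple s) =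
        (racgMatrix Γ).simple a * (racgMatrix Γ).simple s * (racgMatrix Γ).simple a) ∧
      (∀ s ∉ D, φ ((racgMatrix Γ).simple s) = (racgMatrix Γ).simple s)) ∧
    (∀ φ : MulAut (racgMatrix Γ).Group,
      ((∀ s ∈ D, φ ((racgMatrix Γ).simple s) =
        (racgMatrix Γ).simple a * (racgMatrix Γ).simple s * (racgMatrix Γ).simple a) ∧
      (∀ s ∉ D, φ ((racgMatrix Γ).simple s) = (racgMatrix Γ).simple s)) →
      φ * φ = 1 ∧ φ ≠ 1) := by
  have ha : a ∉ D := fun h => hsub h (Or.inl rfl)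
  obtain ⟨F, hFD, hFDc⟩ := RACG.exists_partialConjugation_hom hsub fun s t hs ht h =>
    hcomp s t (hsub hs) ht hs (SimpleGraph.Adj.reachable h)
  have hFF := RACG.partialConjugation_comp_self ha hFD hFDc
  refine ⟨⟨F.toMulEquiv F hFF hFF, ⟨hFD, hFDc⟩, ?_⟩, ?_⟩
  · rintro ψ ⟨hD, hDc⟩
    refine MulEquiv.toMonoidHom_injective (RACG.hom_ext fun s => ?_)
    by_cases hs : s ∈ D
    · exact (hD s hs).trans (hFD s hs).symm
    · exact (hDc s hs).trans (hFDc s hs).symm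
  · rintro φ ⟨hD, hDc⟩
    constructor
    · exact MulEquiv.toMonoidHom_injective
        (RACG.partialConjugation_comp_self (F := φ.toMonoidHom) ha hD hDc)
    · rintro rfl
      obtain ⟨s, hs⟩ := hne
      exact RACG.simple_conj_ne (hsub hs) (hD s hs).symm
end

section
/- Let Γ be a finite simple graph with vertex set S, let W_Γ be the associated right-angled Coxeter group, and let a, d ∈ S be distinct vertices with St(d) ⊆ St(a). Then there is a unique automorphism φ of W_Γ satisfying φ(d) = da and φ(s) = s for all s ∈ S \ {d}; moreover φ ∘ φ is the identity and φ is not the identity. -/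
open Classical in
/-- Generators of `W_Γ` attached to adjacent vertices commute. -/
theorem commute_simple_of_adj {V : Type*} (Γ : SimpleGraph V) {s t : V} (h : Γ.Adj s t) :
    Commute ((racgMatrix Γ).simple s) ((racgMatrix Γ).simple t) := by
  have hpow := (racgMatrix Γ).toCoxeterSystem.simple_mul_simple_pow s t
  have hM : (racgMatrix Γ) s t = 2 := by
    change (if s = t then 1 else if Γ.Adj s t then 2 else 0) = 2
    rw [if_neg h.ne, if_pos h]
  have hinv := (racgMatrix Γ).toCoxeterSystem.inv_simple
  simp only [CoxeterMatrix.toCoxeterSystem_simple] at hpow hinv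
  rw [hM, pow_two] at hpow
  have := eq_inv_of_mul_eq_one_left hpow
  rwa [mul_inv_rev, hinv, hinv] at this

theorem simple_mul_simple_self {V : Type*} (Γ : SimpleGraph V) (s : V) :
    (racgMatrix Γ).simple s * (racgMatrix Γ).simple s = 1 :=
  (racgMatrix Γ).toCoxeterSystem.simple_mul_simple_self s

open Classical in
/-- A map from the vertices to a monoid extends to `W_Γ` as soon as its values square to `1` and
adjacent vertices have commuting values. -/
theorem racgMatrix_isLiftable {V G : Type*} [Monoid G] (Γ : SimpleGraph V) {f : V → G}
    (hsq : ∀ s, f s * f s = 1) (hcomm : ∀ s t, Γ.Adj s t → Commute (f s) (f t)) :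
    (racgMatrix Γ).IsLiftable f := by
  intro s t
  change (f s * f t) ^ (if s = t then 1 else if Γ.Adj s t then 2 else 0) = 1
  split_ifs with hst hadj
  · rw [pow_one, hst, hsq]
  · rw [(hcomm s t hadj).mul_pow, pow_two, pow_two, hsq, hsq, one_mul]
  · exact pow_zero _

theorem adj_of_graphStar_subset {V : Type*} {Γ : SimpleGraph V} {a d : V} (had : a ≠ d)
    (hstar : graphStar Γ d ⊆ graphStar Γ a) : Γ.Adj a d :=
  (hstar (Or.inl rfl : d ∈ graphStar Γ d)).resolve_left had.symm

theorem commute_simple_of_graphStar_subset {V : Type*} {Γ : SimpleGraph V} {a d t : V}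
    (hstar : graphStar Γ d ⊆ graphStar Γ a) (h : Γ.Adj d t) :
    Commute ((racgMatrix Γ).simple a) ((racgMatrix Γ).simple t) := by
  rcases hstar (Or.inr h : t ∈ graphStar Γ d) with rfl | hat
  · exact Commute.refl _
  · exact commute_simple_of_adj Γ hat

open Classical in
theorem transvection_isLiftable {V : Type*} (Γ : SimpleGraph V) {a d : V} (had : a ≠ d)
    (hstar : graphStar Γ d ⊆ graphStar Γ a) :
    (racgMatrix Γ).IsLiftable (Function.update (racgMatrix Γ).simple d
      ((racgMatrix Γ).simple d * (racgMatrix Γ).simple a)) := by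
  have hda := (commute_simple_of_adj Γ (adj_of_graphStar_subset had hstar)).symm
  have hcomm : ∀ t, Γ.Adj d t →
      Commute ((racgMatrix Γ).simple d * (racgMatrix Γ).simple a) ((racgMatrix Γ).simple t) :=
    fun t h => (commute_simple_of_adj Γ h).mul_left (commute_simple_of_graphStar_subset hstar h)
  refine racgMatrix_isLiftable Γ (fun s => ?_) (fun s t hst => ?_)
  · by_cases hs : s = d
    · subst hs
      rw [Function.update_self, hda.symm.mul_mul_mul_comm, simple_mul_simple_self,
        simple_mul_simple_self, one_mul]
    · rw [Function.update_of_ne hs, simple_mul_simple_self]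
  · by_cases hs : s = d
    · subst hs
      rw [Function.update_self, Function.update_of_ne hst.ne']
      exact hcomm t hst
    · rw [Function.update_of_ne hs]
      by_cases ht : t = d
      · subst ht
        rw [Function.update_self]
        exact (hcomm s hst.symm).symm
      · rw [Function.update_of_ne ht]
        exact commute_simple_of_adj Γ hst

/-- Homomorphisms out of `W_Γ` agreeing on the generators are equal. -/
theorem racg_hom_ext {V G : Type*} [Monoid G] {Γ : SimpleGraph V}
    {f g : (racgMatrix Γ).Group →* G}
    (h : ∀ s, f ((racgMatrix Γ).simple s) = g ((racgMatrix Γ).simple s)) : f = g :=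
  (racgMatrix Γ).toCoxeterSystem.ext_simple h

theorem transvection_comp_self {V : Type*} {Γ : SimpleGraph V} {a d : V} (had : a ≠ d)
    {f : (racgMatrix Γ).Group →* (racgMatrix Γ).Group}
    (hd : f ((racgMatrix Γ).simple d) = (racgMatrix Γ).simple d * (racgMatrix Γ).simple a)
    (hs : ∀ s : V, s ≠ d → f ((racgMatrix Γ).simple s) = (racgMatrix Γ).simple s) :
    f.comp f = MonoidHom.id _ := by
  refine racg_hom_ext fun s => ?_
  rw [MonoidHom.comp_apply, MonoidHom.id_apply]
  by_cases h : s = d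
  · rw [h, hd, map_mul, hd, hs a had, mul_assoc, simple_mul_simple_self, mul_one]
  · rw [hs s h, hs s h]

theorem simple_ne_one {V : Type*} (Γ : SimpleGraph V) (s : V) : (racgMatrix Γ).simple s ≠ 1 := by
  intro h
  have hlen := (racgMatrix Γ).toCoxeterSystem.length_simple s
  rw [CoxeterMatrix.toCoxeterSystem_simple, h, CoxeterSystem.length_one] at hlen
  exact zero_ne_one hlen

/-- Existence, uniqueness, and basic properties of the transvection with acting letter `a`
and domain `d`, where `a ≠ d` and `St(d) ⊆ St(a)`. -/
theorem transvection_exists_unique {V : Type*} [Fintype V] (Γ : SimpleGraph V)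
    (a d : V) (had : a ≠ d) (hstar : graphStar Γ d ⊆ graphStar Γ a) :
    (∃! φ : MulAut (racgMatrix Γ).Group,
      φ ((racgMatrix Γ).simple d) = (racgMatrix Γ).simple d * (racgMatrix Γ).simple a ∧
      (∀ s : V, s ≠ d → φ ((racgMatrix Γ).simple s) = (racgMatrix Γ).simple s)) ∧
    (∀ φ : MulAut (racgMatrix Γ).Group,
      (φ ((racgMatrix Γ).simple d) = (racgMatrix Γ).simple d * (racgMatrix Γ).simple a ∧
      (∀ s : V, s ≠ d → φ ((racgMatrix Γ).simple s) = (racgMatrix Γ).simple s)) →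
      φ * φ = 1 ∧ φ ≠ 1) := by
  classical
  refine ⟨?_, ?_⟩
  · have hlift := transvection_isLiftable Γ had hstar
    let f : (racgMatrix Γ).Group →* (racgMatrix Γ).Group :=
      (racgMatrix Γ).toCoxeterSystem.lift ⟨_, hlift⟩
    have hf : ∀ s, f ((racgMatrix Γ).simple s) = Function.update (racgMatrix Γ).simple d
        ((racgMatrix Γ).simple d * (racgMatrix Γ).simple a) s :=
      (racgMatrix Γ).toCoxeterSystem.lift_apply_simple hlift
    have hd : f ((racgMatrix Γ).simple d) = (racgMatrix Γ).simple d * (racgMatrix Γ).simple a := by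
      rw [hf, Function.update_self]
    have hs : ∀ s, s ≠ d → f ((racgMatrix Γ).simple s) = (racgMatrix Γ).simple s := fun s h => by
      rw [hf, Function.update_of_ne h]
    have hff := transvection_comp_self had hd hs
    refine ⟨f.toMulEquiv f hff hff, ⟨hd, hs⟩, fun ψ hψ => ?_⟩
    have hψf : ψ.toMonoidHom = f := racg_hom_ext fun s => by
      by_cases h : s = d
      · rw [h, hd]
        exact hψ.1
      · rw [hs s h]
        exact hψ.2 s h
    exact MulEquiv.ext fun x => DFunLike.congr_fun hψf x
  · rintro φ ⟨hd, hs⟩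
    refine ⟨MulEquiv.ext fun x => ?_, ?_⟩
    · exact DFunLike.congr_fun (transvection_comp_self (f := φ.toMonoidHom) had hd hs) x
    · rintro rfl
      exact simple_ne_one Γ a (left_eq_mul.mp hd)
end

section
/- Let Γ be a finite simple graph with vertex set S, let a ∈ S, let D be a nonempty union of connected components of the induced subgraph of Γ on S \ St(a), let φ be the partial conjugation with acting letter a and domain D, and let G = W_Γ ⋊_φ (ℤ/2ℤ) with z the image in G of the generator of ℤ/2ℤ. Let Λ be the finite simple graph with vertex set S ⊔ {x} and edge set consisting of: all edges of Γ; an edge {x, s} for every s ∈ S \ D; and an edge {a, s} for every s ∈ D. Then the assignment sending the generator s of W_Λ to s ∈ G for each s ∈ S \ {a}, sending the generator a of W_Λ to az ∈ G, and sending the generator x of W_Λ to z ∈ G, extends to a group isomorphism W_Λ ≅ G. In particular, G is a right-angled Coxeter group. -/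
namespace racgMatrix

variable {V : Type*} (Γ : SimpleGraph V)

theorem simple_mul_self (s : V) :
    (racgMatrix Γ).simple s * (racgMatrix Γ).simple s = 1 := by
  simpa using (racgMatrix Γ).toCoxeterSystem.simple_mul_simple_self s

theorem simple_commute {s t : V} (h : Γ.Adj s t) :
    Commute ((racgMatrix Γ).simple s) ((racgMatrix Γ).simple t) := by
  have key := (racgMatrix Γ).toCoxeterSystem.simple_mul_simple_pow s t
  have hM : racgMatrix Γ s t = 2 := by
    classical
    change (if s = t then 1 else if Γ.Adj s t then 2 else 0) = 2
    rw [if_neg h.ne, if_pos h]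
  rw [hM, CoxeterMatrix.toCoxeterSystem_simple, pow_two] at key
  have inv_simple (u : V) := inv_eq_of_mul_eq_one_left (simple_mul_self Γ u)
  have := eq_inv_of_mul_eq_one_left key
  rwa [mul_inv_rev, inv_simple, inv_simple] at this

/-- Involutions indexed by the vertices, commuting along the edges, define a homomorphism
out of the right-angled Coxeter group. -/
theorem exists_lift {G : Type*} [Group G] (f : V → G) (hsq : ∀ s, f s * f s = 1)
    (hcomm : ∀ s t, Γ.Adj s t → Commute (f s) (f t)) :
    ∃ F : (racgMatrix Γ).Group →* G, ∀ s, F ((racgMatrix Γ).simple s) = f s := by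
  have hf : (racgMatrix Γ).IsLiftable f := by
    classical
    intro s t
    change (f s * f t) ^ (if s = t then 1 else if Γ.Adj s t then 2 else 0) = 1
    split_ifs with hst hadj
    · rw [hst, pow_one, hsq]
    · rw [(hcomm s t hadj).mul_pow, pow_two, pow_two, hsq, hsq, one_mul]
    · rw [pow_zero]
  exact ⟨(racgMatrix Γ).toCoxeterSystem.lift ⟨f, hf⟩, fun s => by
    simpa using (racgMatrix Γ).toCoxeterSystem.lift_apply_simple hf s⟩

theorem hom_ext {G : Type*} [Monoid G] {F F' : (racgMatrix Γ).Group →* G}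
    (h : ∀ s, F ((racgMatrix Γ).simple s) = F' ((racgMatrix Γ).simple s)) : F = F' :=
  (racgMatrix Γ).toCoxeterSystem.ext_simple (by simpa using h)

end racgMatrix

theorem Multiplicative.zmod_two_cases (g : Multiplicative (ZMod 2)) :
    g = 1 ∨ g = Multiplicative.ofAdd (1 : ZMod 2) := by
  revert g
  decide

theorem exists_hom_of_mul_self_eq_one {G : Type*} [Group G] (x : G) (hx : x * x = 1) :
    ∃ F : Multiplicative (ZMod 2) →* G, F (Multiplicative.ofAdd (1 : ZMod 2)) = x := by
  have hne : (Multiplicative.ofAdd (1 : ZMod 2)) ≠ 1 := by decide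
  have hmul : Multiplicative.ofAdd (1 : ZMod 2) * Multiplicative.ofAdd (1 : ZMod 2) = 1 := by
    decide
  refine ⟨MonoidHom.mk' (fun g => if g = 1 then 1 else x) fun g h => ?_,
    if_neg (t := (1 : G)) hne⟩
  rcases Multiplicative.zmod_two_cases g with rfl | rfl <;>
    rcases Multiplicative.zmod_two_cases h with rfl | rfl <;> simp [hne, hmul, hx]

/-- If `a` is an involution commuting with `s` and `x`, then conjugating `s` by `a * x` is the same as conjugating it by `x`. -/
theorem mul_conj_eq_of_commute {G : Type*} [Group G] {a s x : G} (ha : a * a = 1)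
    (has : Commute a s) (hax : Commute a x) : a * x * s * (a * x) = x * s * x := by
  rw [hax.eq, mul_assoc x a s, has.eq, mul_assoc x, mul_assoc s, hax.eq.symm, ← mul_assoc a a, ha,
    one_mul, ← mul_assoc]

/-- If `φ` is the partial conjugation of `W_Γ` with acting letter `a` and domain `D`, and
`Λ` is the graph obtained from `Γ` by adding a new vertex `x` joined to everything outside
`D` and joining the vertex `a` (relabelled `ax`) to everything in `D`, then the assignment
`s ↦ s` (for `s ≠ a`), `a ↦ az`, `x ↦ z` extends to an isomorphism
`W_Λ ≅ G = W_Γ ⋊_φ ℤ/2ℤ`.  In particular `G` is a right-angled Coxeter group. -/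
theorem semidirect_by_partialConjugation_isRACG {V : Type*} [Fintype V]
    (Γ : SimpleGraph V) (a : V) (D : Set V)
    (hne : D.Nonempty) (hsub : D ⊆ (graphStar Γ a)ᶜ)
    (hcomp : ∀ (s t : V) (hs : s ∈ (graphStar Γ a)ᶜ) (ht : t ∈ (graphStar Γ a)ᶜ),
      s ∈ D → (Γ.induce ((graphStar Γ a)ᶜ : Set V)).Reachable ⟨s, hs⟩ ⟨t, ht⟩ → t ∈ D)
    (φ : MulAut (racgMatrix Γ).Group)
    (hφ₁ : ∀ s ∈ D, φ ((racgMatrix Γ).simple s) =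
      (racgMatrix Γ).simple a * (racgMatrix Γ).simple s * (racgMatrix Γ).simple a)
    (hφ₂ : ∀ s ∉ D, φ ((racgMatrix Γ).simple s) = (racgMatrix Γ).simple s)
    (ψ : Multiplicative (ZMod 2) →* MulAut (racgMatrix Γ).Group)
    (hψ : ψ (Multiplicative.ofAdd (1 : ZMod 2)) = φ)
    (Λ : SimpleGraph (Option V))
    (hΛ₁ : ∀ s t : V, Λ.Adj (some s) (some t) ↔
      (Γ.Adj s t ∨ (s = a ∧ t ∈ D) ∨ (t = a ∧ s ∈ D)))
    (hΛ₂ : ∀ s : V, Λ.Adj none (some s) ↔ s ∉ D) :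
    ∃ iso : (racgMatrix Λ).Group ≃*
        ((racgMatrix Γ).Group ⋊[ψ] Multiplicative (ZMod 2)),
      (∀ s : V, s ≠ a → iso ((racgMatrix Λ).simple (some s)) =
        SemidirectProduct.inl ((racgMatrix Γ).simple s)) ∧
      iso ((racgMatrix Λ).simple (some a)) =
        SemidirectProduct.inl ((racgMatrix Γ).simple a) *
          SemidirectProduct.inr (Multiplicative.ofAdd (1 : ZMod 2)) ∧
      iso ((racgMatrix Λ).simple none) =
        SemidirectProduct.inr (Multiplicative.ofAdd (1 : ZMod 2)) := by
  classical
  set z : Multiplicative (ZMod 2) := Multiplicative.ofAdd (1 : ZMod 2)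
  have hzz : z * z = 1 := by decide
  have haD : a ∉ D := fun h => hsub h (Or.inl rfl)
  have hadjD {t : V} (h : Γ.Adj a t) : t ∉ D := fun ht => hsub ht (Or.inr h)
  -- relations in the semidirect product
  let W := (racgMatrix Γ).Group ⋊[ψ] Multiplicative (ZMod 2)
  let i : V → W := fun s => SemidirectProduct.inl ((racgMatrix Γ).simple s)
  let r : W := SemidirectProduct.inr z
  have hr : r * r = 1 := by
    change SemidirectProduct.inr z * SemidirectProduct.inr z = (1 : W)
    rw [← map_mul, hzz, map_one]
  have hrinv : r⁻¹ = r := inv_eq_of_mul_eq_one_left hr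
  have hi (s : V) : i s * i s = 1 := by
    change SemidirectProduct.inl _ * SemidirectProduct.inl _ = (1 : W)
    rw [← map_mul, racgMatrix.simple_mul_self, map_one]
  have hii {s t : V} (h : Γ.Adj s t) : Commute (i s) (i t) :=
    (racgMatrix.simple_commute Γ h).map SemidirectProduct.inl
  have hconj (s : V) :
      r * i s * r = SemidirectProduct.inl (φ ((racgMatrix Γ).simple s)) := by
    rw [← hψ, SemidirectProduct.inl_aut, map_inv]
    change r * i s * r = r * i s * r⁻¹
    rw [hrinv]
  have hri {s : V} (h : s ∉ D) : Commute r (i s) := by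
    have := hconj s
    rw [hφ₂ s h] at this
    exact eq_mul_inv_of_mul_eq this |>.trans (by rw [hrinv])
  have hrD {s : V} (h : s ∈ D) : Commute (i a * r) (i s) := by
    have := hconj s
    rw [hφ₁ s h, map_mul, map_mul] at this
    change r * i s * r = i a * i s * i a at this
    calc i a * r * i s = i a * (r * i s * r) * r := by
          rw [mul_assoc _ _ r, mul_assoc _ r r, hr, mul_one, mul_assoc]
      _ = i s * (i a * r) := by
          rw [this, ← mul_assoc, ← mul_assoc, hi, one_mul, mul_assoc]
  -- relations in the group of `Λ`
  let j : V → (racgMatrix Λ).Group := fun s => (racgMatrix Λ).simple (some s)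
  let x : (racgMatrix Λ).Group := (racgMatrix Λ).simple none
  have hj (s : V) : j s * j s = 1 := racgMatrix.simple_mul_self Λ _
  have hx : x * x = 1 := racgMatrix.simple_mul_self Λ _
  have hjj {s t : V} (h : Γ.Adj s t) : Commute (j s) (j t) :=
    racgMatrix.simple_commute Λ ((hΛ₁ s t).2 (Or.inl h))
  have haj {s : V} (h : s ∈ D) : Commute (j a) (j s) :=
    racgMatrix.simple_commute Λ ((hΛ₁ a s).2 (Or.inr (Or.inl ⟨rfl, h⟩)))
  have hxj {s : V} (h : s ∉ D) : Commute x (j s) :=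
    racgMatrix.simple_commute Λ ((hΛ₂ s).2 h)
  obtain ⟨F, hF⟩ := racgMatrix.exists_lift Λ
    (fun o => o.elim r fun s => if s = a then i a * r else i s)
    (by
      rintro (_ | s)
      · exact hr
      · by_cases hs : s = a
        · simp only [Option.elim_some, if_pos hs]
          rw [mul_assoc, ← mul_assoc r, (hri haD).eq, mul_assoc, hr, mul_one, hi]
        · simpa only [Option.elim_some, if_neg hs] using hi s)
    (by
      have hnone (s : V) (h : s ∉ D) : Commute r (if s = a then i a * r else i s) := by
        split_ifs
        · exact (hri haD).mul_right (Commute.refl r)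
        · exact hri h
      have ha (t : V) (hta : t ≠ a) (h : Γ.Adj a t ∨ t ∈ D) : Commute (i a * r) (i t) := by
        rcases h with h | h
        · exact (hii h).mul_left (hri (hadjD h))
        · exact hrD h
      rintro (_ | s) (_ | t) hst
      · exact Commute.refl _
      · exact hnone t ((hΛ₂ t).1 hst)
      · exact (hnone s ((hΛ₂ s).1 hst.symm)).symm
      · have hne' : s ≠ t := fun h => hst.ne (congrArg some h)
        rw [hΛ₁] at hst
        simp only [Option.elim_some]
        split_ifs with hs ht ht
        · exact Commute.refl _
        · subst hs
          exact ha t ht (by tauto)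
        · subst ht
          exact (ha s hs (by rw [Γ.adj_comm]; tauto)).symm
        · exact hii (by tauto))
  have hFa : F (j a) = i a * r := by simpa using hF (some a)
  have hFs {s : V} (hs : s ≠ a) : F (j s) = i s := by simpa [hs] using hF (some s)
  have hFx : F x = r := by simpa using hF none
  obtain ⟨fn, hfn⟩ := racgMatrix.exists_lift Γ (fun s => if s = a then j a * x else j s)
    (by
      intro s
      split_ifs
      · rw [mul_assoc, ← mul_assoc x, (hxj haD).eq, mul_assoc, hx, mul_one, hj]
      · exact hj s)
    (by
      intro s t hst
      split_ifs with hs ht ht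
      · exact Commute.refl _
      · subst hs
        exact (hjj hst).mul_left (hxj (hadjD hst))
      · subst ht
        exact (hjj hst).mul_right (hxj (hadjD hst.symm)).symm
      · exact hjj hst)
  have hfna : fn ((racgMatrix Γ).simple a) = j a * x := by simpa using hfn a
  have hfns {s : V} (hs : s ≠ a) : fn ((racgMatrix Γ).simple s) = j s := by
    simpa [hs] using hfn s
  obtain ⟨fg, hfg : fg z = x⟩ := exists_hom_of_mul_self_eq_one x hx
  have hxinv : x⁻¹ = x := inv_eq_of_mul_eq_one_left hx
  have hcompat (g : Multiplicative (ZMod 2)) :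
      fn.comp (ψ g).toMonoidHom = (MulAut.conj (fg g)).toMonoidHom.comp fn := by
    rcases Multiplicative.zmod_two_cases g with rfl | rfl
    · ext; simp
    · refine racgMatrix.hom_ext Γ fun s => ?_
      change fn (ψ z _) = fg z * fn _ * (fg z)⁻¹
      rw [hψ, hfg, hxinv]
      by_cases hs : s ∈ D
      · have hsa : s ≠ a := fun h => haD (h ▸ hs)
        rw [hφ₁ s hs, map_mul, map_mul, hfna, hfns hsa]
        exact mul_conj_eq_of_commute (hj a) (haj hs) (hxj haD).symm
      · have hcomm : Commute x (fn ((racgMatrix Γ).simple s)) := by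
          by_cases hsa : s = a
          · rw [hsa, hfna]
            exact (hxj haD).mul_right (Commute.refl x)
          · rw [hfns hsa]
            exact hxj hs
        rw [hφ₂ s hs, hcomm.eq, mul_assoc, hx, mul_one]
  let B : W →* (racgMatrix Λ).Group := SemidirectProduct.lift fn fg hcompat
  have hBi (s : V) : B (i s) = fn ((racgMatrix Γ).simple s) := SemidirectProduct.lift_inl ..
  have hBr : B r = x := (SemidirectProduct.lift_inr ..).trans hfg
  refine ⟨MonoidHom.toMulEquiv F B ?_ ?_, fun s hs => hFs hs, hFa, hFx⟩
  · refine racgMatrix.hom_ext Λ fun o => ?_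
    rcases o with _ | s
    · exact (congrArg B hFx).trans hBr
    · by_cases hs : s = a
      · subst hs
        refine (congrArg B hFa).trans ?_
        rw [map_mul, hBi, hBr, hfna, mul_assoc, hx, mul_one]
        rfl
      · exact (congrArg B (hFs hs)).trans ((hBi s).trans (hfns hs))
  · refine SemidirectProduct.hom_ext (racgMatrix.hom_ext Γ fun s => ?_) ?_
    · refine (congrArg F (hBi s)).trans ?_
      by_cases hs : s = a
      · subst hs
        rw [hfna, map_mul, hFa, hFx, mul_assoc, hr, mul_one]
        rfl
      · rw [hfns hs]
        exact hFs hs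
    · refine MonoidHom.ext fun g => ?_
      rcases Multiplicative.zmod_two_cases g with rfl | rfl
      · rw [map_one, map_one]
      · exact (congrArg F hBr).trans hFx
end

section
/- Let Γ be a finite simple graph and let W_Γ be the associated right-angled Coxeter group. Then every element w ∈ W_Γ of finite order satisfies w² = 1; that is, every nontrivial finite-order element of a right-angled Coxeter group is an involution. -/
namespace Monoid.CoprodI

section Torsion

variable {ι : Type*} {G : ι → Type*} [∀ i, Group (G i)]

/-- The element of the free product spelled by a (not necessarily reduced) list of letters. -/
def listProd (l : List (Σ i, G i)) : CoprodI G := (l.map fun x => of x.2).prod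

@[simp]
theorem listProd_append (a b : List (Σ i, G i)) :
    listProd (a ++ b) = listProd a * listProd b := by
  simp [listProd]

@[simp]
theorem listProd_cons (x : Σ i, G i) (b : List (Σ i, G i)) :
    listProd (x :: b) = of x.2 * listProd b := by
  simp [listProd]

@[simp]
theorem listProd_nil : listProd ([] : List (Σ i, G i)) = 1 := rfl

theorem exists_listProd_eq (h : CoprodI G) : ∃ l, listProd l = h := by
  induction h using CoprodI.induction_on with
  | one => exact ⟨[], rfl⟩
  | of i m => exact ⟨[⟨i, m⟩], by simp⟩
  | mul x y hx hy =>
    obtain ⟨a, rfl⟩ := hx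
    obtain ⟨b, rfl⟩ := hy
    exact ⟨a ++ b, by simp⟩

theorem listProd_ne_one {l : List (Σ i, G i)} (hne : l ≠ []) (h1 : ∀ x ∈ l, x.2 ≠ 1)
    (hc : l.IsChain fun x y => x.1 ≠ y.1) : listProd l ≠ 1 := by
  classical
  intro h
  let w : Word G := ⟨l, fun x hx => h1 x hx, hc⟩
  have hw : w = Word.empty := Word.equiv.symm.injective (h : w.prod = (Word.empty : Word G).prod)
  exact hne (congrArg Word.toList hw)

theorem isConj_listProd_append_comm (a b : List (Σ i, G i)) :
    IsConj (listProd (a ++ b)) (listProd (b ++ a)) :=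
  isConj_iff.2 ⟨(listProd a)⁻¹, by simp⟩

theorem listProd_flatten_replicate (l : List (Σ i, G i)) (n : ℕ) :
    listProd (List.replicate n l).flatten = listProd l ^ n := by
  induction n with
  | zero => simp
  | succ n ih => simp [List.replicate_succ, ih, pow_succ']

/-- A cyclically reduced list of letters spells an element of infinite order. -/
theorem not_isOfFinOrder_listProd {l : List (Σ i, G i)} (hne : l ≠ []) (h1 : ∀ x ∈ l, x.2 ≠ 1)
    (hc : l.IsChain fun x y => x.1 ≠ y.1)
    (hcyc : ∀ x ∈ l.getLast?, ∀ y ∈ l.head?, x.1 ≠ y.1) : ¬ IsOfFinOrder (listProd l) := by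
  have key (n : ℕ) : ((List.replicate n l).flatten.IsChain fun x y => x.1 ≠ y.1) := by
    induction n with
    | zero => simp
    | succ n ih =>
      rw [List.replicate_succ, List.flatten_cons]
      refine hc.append ih fun x hx y hy => hcyc x hx y ?_
      cases n with
      | zero => simp at hy
      | succ n =>
        rw [List.replicate_succ, List.flatten_cons, List.head?_append_of_ne_nil _ hne] at hy
        exact hy
  rw [isOfFinOrder_iff_pow_eq_one]
  rintro ⟨n, hn, h⟩
  rw [← listProd_flatten_replicate] at h
  refine listProd_ne_one ?_ ?_ (key n) h
  · simp [hn.ne', hne]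
  · intro x hx
    obtain ⟨l', hl', hx⟩ := List.mem_flatten.1 hx
    rw [List.eq_of_mem_replicate hl'] at hx
    exact h1 x hx

/-- An element of finite order of a free product of groups is trivial or conjugate into a
factor. -/
theorem eq_one_or_isConj_of_of_isOfFinOrder {h : CoprodI G} (hh : IsOfFinOrder h) :
    h = 1 ∨ ∃ i, ∃ m : G i, IsConj h (of m) := by
  classical
  have hex : ∃ k, ∃ l : List (Σ i, G i), l.length = k ∧ IsConj h (listProd l) := by
    obtain ⟨l, rfl⟩ := exists_listProd_eq h
    exact ⟨_, l, rfl, IsConj.refl _⟩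
  obtain ⟨l, hl, hconj⟩ := Nat.find_spec hex
  have hmin (l' : List (Σ i, G i)) (h' : IsConj h (listProd l')) : l.length ≤ l'.length :=
    hl ▸ Nat.find_min' hex ⟨l', rfl, h'⟩
  match l, hconj, hmin with
  | [], hconj, _ => exact .inl (isConj_one_right.1 hconj.symm)
  | [⟨i, m⟩], hconj, _ => exact .inr ⟨i, m, by simpa using hconj⟩
  | x :: y :: t, hconj, hmin =>
    refine absurd ?_ (not_isOfFinOrder_listProd (l := x :: y :: t) (by simp) ?_ ?_ ?_)
    · obtain ⟨c, hc⟩ := isConj_iff.1 hconj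
      rw [← hc, ← MulAut.conj_apply]
      exact MonoidHom.isOfFinOrder (MulAut.conj c).toMonoidHom hh
    · intro z hz hz1
      obtain ⟨a, b, hab⟩ := List.append_of_mem hz
      have := hmin (a ++ b) (by rw [hab] at hconj; simpa [hz1] using hconj)
      rw [hab] at this
      simp at this
    · rw [List.isChain_iff_forall_rel_of_append_cons_cons]
      rintro ⟨i, p⟩ ⟨j, q⟩ a b hab (rfl : i = j)
      have := hmin (a ++ ⟨i, p * q⟩ :: b) (by
        rw [hab] at hconj; simpa [mul_assoc] using hconj)
      rw [hab] at this
      simp at this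
    · rintro ⟨j, q⟩ hz ⟨i, p⟩ hx (rfl : j = i)
      obtain ⟨t', ht'⟩ : ∃ t', y :: t = t' ++ [⟨j, q⟩] :=
        List.getLast?_eq_some_iff.1 (by simpa using hz)
      obtain rfl : x = ⟨j, p⟩ := by simpa using hx
      rw [ht'] at hconj hmin
      have h2 := hconj.trans (isConj_listProd_append_comm (⟨j, p⟩ :: t') [⟨j, q⟩])
      have := hmin (⟨j, q * p⟩ :: t') (by simpa [mul_assoc] using h2)
      simp at this

end Torsion

section Permute

variable {ι : Type*} (A : Type*) [Group A]

/-- The action of permutations of the index set on a free power of a group. -/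
def permAut : Equiv.Perm ι →* MulAut (CoprodI fun _ : ι => A) where
  toFun σ := MonoidHom.toMulEquiv
    (CoprodI.lift fun i => of (M := fun _ : ι => A) (i := σ i))
    (CoprodI.lift fun i => of (M := fun _ : ι => A) (i := σ.symm i))
    (by ext i a; simp) (by ext i a; simp)
  map_one' := by
    apply MulEquiv.toMonoidHom_injective
    ext i a
    simp
  map_mul' σ τ := by
    apply MulEquiv.toMonoidHom_injective
    ext i a
    simp

@[simp]
theorem permAut_of (σ : Equiv.Perm ι) (i : ι) (a : A) :
    permAut A σ (of (M := fun _ : ι => A) (i := i) a) = of (M := fun _ : ι => A) (i := σ i) a := by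
  simp [permAut]

end Permute

end Monoid.CoprodI

/-- Conjugation as an action of a group on a conjugacy class. -/
def conjPerm {W : Type*} [Group W] (s : W) : W →* Equiv.Perm {r : W // IsConj s r} where
  toFun g := (MulAut.conj g).toEquiv.subtypeEquiv fun r =>
    ⟨fun h => h.trans (isConj_iff.2 ⟨g, rfl⟩),
      fun h => h.trans (isConj_iff.2 ⟨g⁻¹, by simp [mul_assoc]⟩)⟩
  map_one' := by ext; simp
  map_mul' g h := by ext; simp

@[simp]
theorem coe_conjPerm_apply {W : Type*} [Group W] (s g : W) (r : {r : W // IsConj s r}) :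
    (conjPerm s g r : W) = g * r * g⁻¹ := rfl

/-- The homomorphism from the group of order two determined by an involution. -/
def involutionHom {W : Type*} [Group W] (r : W) (hr : r * r = 1) :
    Multiplicative (ZMod 2) →* W :=
  MonoidHom.mk' (fun x => if x = 1 then 1 else r) fun x y => by
    obtain rfl | rfl : x = 1 ∨ x = Multiplicative.ofAdd 1 := by revert x; decide
    · simp
    · obtain rfl | rfl : y = 1 ∨ y = Multiplicative.ofAdd 1 := by revert y; decide
      · simp
      · have h1 : Multiplicative.ofAdd (1 : ZMod 2) ≠ 1 := by decide
        have h2 : Multiplicative.ofAdd (1 : ZMod 2) * Multiplicative.ofAdd 1 = 1 := rfl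
        simp [h1, h2, hr]

theorem involutionHom_apply {W : Type*} [Group W] (r : W) (hr : r * r = 1)
    (x : Multiplicative (ZMod 2)) : involutionHom r hr x = if x = 1 then 1 else r := rfl

theorem IsConj.mul_self_eq_one {W : Type*} [Group W] {s r : W} (h : IsConj s r)
    (hs : s * s = 1) : r * r = 1 := by
  obtain ⟨c, rfl⟩ := isConj_iff.1 h
  rw [conj_mul, hs, mul_one, mul_inv_cancel]

section

variable {V : Type*} (Γ : SimpleGraph V)

theorem racgMatrix_isLiftable_s6 {G : Type*} [Group G] {f : V → G} (h1 : ∀ v, f v * f v = 1)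
    (h2 : ∀ u v, Γ.Adj u v → Commute (f u) (f v)) : (racgMatrix Γ).IsLiftable f := by
  intro u v
  by_cases huv : u = v
  · subst huv
    simp [h1]
  · by_cases ha : Γ.Adj u v
    · have : (racgMatrix Γ) u v = 2 := by simp [racgMatrix, huv, ha]
      rw [this, (h2 u v ha).mul_pow, pow_two, pow_two, h1, h1, one_mul]
    · have : (racgMatrix Γ) u v = 0 := by simp [racgMatrix, huv, ha]
      rw [this, pow_zero]

theorem racg_commute_simple {u v : V} (h : Γ.Adj u v) :
    Commute ((racgMatrix Γ).simple u) ((racgMatrix Γ).simple v) := by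
  have h2 := (racgMatrix Γ).toCoxeterSystem.simple_mul_simple_pow u v
  have : (racgMatrix Γ) u v = 2 := by simp [racgMatrix, h.ne, h]
  rw [this, CoxeterMatrix.toCoxeterSystem_simple, pow_two] at h2
  have hs (v) : ((racgMatrix Γ).simple v)⁻¹ = (racgMatrix Γ).simple v :=
    (racgMatrix Γ).toCoxeterSystem.inv_simple v
  have h3 := eq_inv_of_mul_eq_one_left h2
  rwa [mul_inv_rev, hs, hs] at h3

theorem racg_simple_mul_self (v : V) :
    (racgMatrix Γ).simple v * (racgMatrix Γ).simple v = 1 :=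
  (racgMatrix Γ).toCoxeterSystem.simple_mul_simple_self v

open Classical in
/-- The retraction of a right-angled Coxeter group killing one generator. -/
noncomputable def racgKill (s : V) : (racgMatrix Γ).Group →* (racgMatrix Γ).Group :=
  (racgMatrix Γ).toCoxeterSystem.lift ⟨fun v => if v = s then 1 else (racgMatrix Γ).simple v,
    racgMatrix_isLiftable_s6 Γ (fun v => by split_ifs <;> simp [racg_simple_mul_self])
      fun u v h => by split_ifs <;> simp [racg_commute_simple Γ h]⟩

open Classical in
theorem racgKill_simple (s v : V) : racgKill Γ s ((racgMatrix Γ).simple v) =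
    if v = s then 1 else (racgMatrix Γ).simple v :=
  (racgMatrix Γ).toCoxeterSystem.lift_apply_simple _ v

/-- The free product of copies of the group of order two indexed by the conjugates of a
generator. -/
abbrev RacgFree (s : V) : Type _ := Monoid.CoprodI
  fun _ : {r : (racgMatrix Γ).Group // IsConj ((racgMatrix Γ).simple s) r} =>
    Multiplicative (ZMod 2)

/-- The conjugation action of a right-angled Coxeter group on `RacgFree`. -/
noncomputable def racgAut (s : V) : (racgMatrix Γ).Group →* MulAut (RacgFree Γ s) :=
  (Monoid.CoprodI.permAut _).comp (conjPerm _)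

/-- The generator of `RacgFree` indexed by the simple reflection itself. -/
noncomputable def racgFreeGen (s : V) : RacgFree Γ s :=
  Monoid.CoprodI.of (i := (⟨(racgMatrix Γ).simple s, IsConj.refl _⟩ :
    {r : (racgMatrix Γ).Group // IsConj ((racgMatrix Γ).simple s) r}))
    (Multiplicative.ofAdd (1 : ZMod 2))

theorem racgFreeGen_mul_self (s : V) : racgFreeGen Γ s * racgFreeGen Γ s = 1 := by
  rw [racgFreeGen, ← map_mul, show Multiplicative.ofAdd (1 : ZMod 2) * Multiplicative.ofAdd 1 = 1
    from rfl, map_one]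

theorem racgAut_racgFreeGen {s v : V} (h : Γ.Adj v s) :
    racgAut Γ s ((racgMatrix Γ).simple v) (racgFreeGen Γ s) = racgFreeGen Γ s := by
  simp only [racgAut, racgFreeGen, MonoidHom.comp_apply, Monoid.CoprodI.permAut_of]
  congr 2
  ext
  simp [(racg_commute_simple Γ h).eq]

/-- The map from `RacgFree` to the Coxeter group sending each generator to the corresponding
reflection. -/
noncomputable def racgFreeHom (s : V) : RacgFree Γ s →* (racgMatrix Γ).Group :=
  Monoid.CoprodI.lift fun r => involutionHom r.1 (r.2.mul_self_eq_one (racg_simple_mul_self Γ s))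

theorem racgFreeHom_racgFreeGen (s : V) :
    racgFreeHom Γ s (racgFreeGen Γ s) = (racgMatrix Γ).simple s := by
  have h1 : Multiplicative.ofAdd (1 : ZMod 2) ≠ 1 := by decide
  rw [racgFreeHom, racgFreeGen, Monoid.CoprodI.lift_of, involutionHom_apply, if_neg h1]

theorem racgFreeHom_comp_racgAut (s : V) (g : (racgMatrix Γ).Group) :
    (racgFreeHom Γ s).comp (racgAut Γ s g).toMonoidHom =
      (MulAut.conj g).toMonoidHom.comp (racgFreeHom Γ s) := by
  refine Monoid.CoprodI.ext_hom _ _ fun r => MonoidHom.ext fun x => ?_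
  simp only [racgFreeHom, racgAut, MonoidHom.comp_apply, MulEquiv.toMonoidHom_eq_coe,
    MonoidHom.coe_coe, Monoid.CoprodI.permAut_of, Monoid.CoprodI.lift_of, involutionHom_apply,
    coe_conjPerm_apply, MulAut.conj_apply]
  split_ifs <;> simp

/-- The map from the semidirect product back to the Coxeter group. -/
noncomputable def racgOfSemidirect (s : V) :
    RacgFree Γ s ⋊[racgAut Γ s] (racgMatrix Γ).Group →* (racgMatrix Γ).Group :=
  SemidirectProduct.lift (racgFreeHom Γ s) (MonoidHom.id _) (racgFreeHom_comp_racgAut Γ s)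

open Classical in
/-- The splitting of a right-angled Coxeter group over the retraction killing a generator. -/
noncomputable def racgToSemidirect (s : V) :
    (racgMatrix Γ).Group →* RacgFree Γ s ⋊[racgAut Γ s] (racgMatrix Γ).Group :=
  (racgMatrix Γ).toCoxeterSystem.lift ⟨fun v =>
      if v = s then SemidirectProduct.inl (racgFreeGen Γ s)
      else SemidirectProduct.inr ((racgMatrix Γ).simple v),
    racgMatrix_isLiftable_s6 Γ
      (fun v => by
        split_ifs
        · rw [← map_mul, racgFreeGen_mul_self, map_one]
        · rw [← map_mul, racg_simple_mul_self, map_one])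
      fun u v h => by
        have key {t : V} (ht : Γ.Adj t s) : Commute
            (SemidirectProduct.inr ((racgMatrix Γ).simple t) :
              RacgFree Γ s ⋊[racgAut Γ s] (racgMatrix Γ).Group)
            (SemidirectProduct.inl (racgFreeGen Γ s)) := by
          ext <;> simp [racgAut_racgFreeGen Γ ht]
        split_ifs with hu hv hv
        · exact Commute.refl _
        · exact (key (hu ▸ h.symm)).symm
        · exact key (hv ▸ h)
        · exact (racg_commute_simple Γ h).map SemidirectProduct.inr⟩

open Classical in
theorem racgToSemidirect_simple (s v : V) : racgToSemidirect Γ s ((racgMatrix Γ).simple v) =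
    if v = s then SemidirectProduct.inl (racgFreeGen Γ s)
      else SemidirectProduct.inr ((racgMatrix Γ).simple v) :=
  (racgMatrix Γ).toCoxeterSystem.lift_apply_simple _ v

theorem racgOfSemidirect_racgToSemidirect (s : V) (w : (racgMatrix Γ).Group) :
    racgOfSemidirect Γ s (racgToSemidirect Γ s w) = w := by
  suffices h : (racgOfSemidirect Γ s).comp (racgToSemidirect Γ s) = MonoidHom.id _ from
    DFunLike.congr_fun h w
  refine (racgMatrix Γ).toCoxeterSystem.ext_simple fun v => ?_
  rw [CoxeterMatrix.toCoxeterSystem_simple, MonoidHom.comp_apply, racgToSemidirect_simple,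
    racgOfSemidirect]
  split_ifs with h
  · rw [SemidirectProduct.lift_inl, racgFreeHom_racgFreeGen, h, MonoidHom.id_apply]
  · rw [SemidirectProduct.lift_inr]

theorem right_racgToSemidirect (s : V) (w : (racgMatrix Γ).Group) :
    (racgToSemidirect Γ s w).right = racgKill Γ s w := by
  suffices h : SemidirectProduct.rightHom.comp (racgToSemidirect Γ s) = racgKill Γ s from
    DFunLike.congr_fun h w
  refine (racgMatrix Γ).toCoxeterSystem.ext_simple fun v => ?_
  rw [CoxeterMatrix.toCoxeterSystem_simple, MonoidHom.comp_apply, racgToSemidirect_simple,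
    racgKill_simple]
  split_ifs <;> simp

/-- A finite-order element in the kernel of the retraction killing `s` is trivial or a conjugate
of `s`. -/
theorem eq_one_or_isConj_of_racgKill_eq_one {s : V} {w : (racgMatrix Γ).Group}
    (hw : IsOfFinOrder w) (hk : racgKill Γ s w = 1) :
    w = 1 ∨ IsConj ((racgMatrix Γ).simple s) w := by
  have hinl : racgToSemidirect Γ s w = SemidirectProduct.inl (racgToSemidirect Γ s w).left := by
    ext
    · simp
    · rw [right_racgToSemidirect, hk, SemidirectProduct.right_inl]
  have hleft : racgFreeHom Γ s (racgToSemidirect Γ s w).left = w := by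
    rw [← SemidirectProduct.lift_inl (racgFreeHom Γ s) (MonoidHom.id _)
      (racgFreeHom_comp_racgAut Γ s), ← hinl]
    exact racgOfSemidirect_racgToSemidirect Γ s w
  have hfin : IsOfFinOrder (racgToSemidirect Γ s w).left := by
    rw [← Function.Injective.isOfFinOrder_iff (f := SemidirectProduct.inl (φ := racgAut Γ s))
      SemidirectProduct.inl_injective, ← hinl]
    exact MonoidHom.isOfFinOrder _ hw
  obtain h | ⟨r, m, h⟩ := Monoid.CoprodI.eq_one_or_isConj_of_of_isOfFinOrder hfin
  · left
    rw [← hleft, h, map_one]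
  · have h' := (racgFreeHom Γ s).map_isConj h
    rw [hleft, racgFreeHom, Monoid.CoprodI.lift_of, involutionHom_apply] at h'
    split_ifs at h'
    · exact .inl (isConj_one_right.1 h'.symm)
    · exact .inr (r.2.trans h'.symm)

theorem not_isConj_simple_mul_self {s : V} (w : (racgMatrix Γ).Group) :
    ¬ IsConj ((racgMatrix Γ).simple s) (w * w) := by
  intro h
  have h1 := isConj_iff_eq.1 ((racgMatrix Γ).toCoxeterSystem.lengthParity.map_isConj h)
  rw [← CoxeterMatrix.toCoxeterSystem_simple, CoxeterSystem.lengthParity_simple, map_mul] at h1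
  generalize (racgMatrix Γ).toCoxeterSystem.lengthParity w = x at h1
  revert x
  decide

theorem racg_mul_self_eq_one_of_kill (l : List V) (w : (racgMatrix Γ).Group)
    (hw : IsOfFinOrder w) (hl : l.foldl (fun u s => racgKill Γ s u) w = 1) : w * w = 1 := by
  induction l generalizing w with
  | nil => rw [show w = 1 from hl, one_mul]
  | cons s l ih =>
    have h := ih (racgKill Γ s w) (MonoidHom.isOfFinOrder _ hw) hl
    rw [← map_mul] at h
    refine (eq_one_or_isConj_of_racgKill_eq_one Γ ?_ h).resolve_right
      (not_isConj_simple_mul_self Γ w)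
    rw [← pow_two]
    exact hw.pow

theorem foldl_racgKill_one (l : List V) :
    l.foldl (fun u s => racgKill Γ s u) (1 : (racgMatrix Γ).Group) = 1 := by
  induction l with
  | nil => rfl
  | cons s l ih => rwa [List.foldl_cons, map_one]

theorem foldl_racgKill_mul (l : List V) (w w' : (racgMatrix Γ).Group) :
    l.foldl (fun u s => racgKill Γ s u) (w * w') =
      l.foldl (fun u s => racgKill Γ s u) w * l.foldl (fun u s => racgKill Γ s u) w' := by
  induction l generalizing w w' with
  | nil => rfl
  | cons s l ih => rw [List.foldl_cons, map_mul, ih]; rfl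

theorem foldl_racgKill_simple {l : List V} {v : V} (hv : v ∈ l) :
    l.foldl (fun u s => racgKill Γ s u) ((racgMatrix Γ).simple v) = 1 := by
  induction l with
  | nil => simp at hv
  | cons s l ih =>
    rw [List.foldl_cons, racgKill_simple]
    split_ifs with h
    · exact foldl_racgKill_one Γ l
    · exact ih ((List.mem_cons.1 hv).resolve_left h)

end

/-- Every finite-order element of a right-angled Coxeter group is an involution:
if `w ∈ W_Γ` has finite order then `w² = 1`. -/
theorem racg_finOrder_is_involution {V : Type*} [Fintype V] (Γ : SimpleGraph V)
    (w : (racgMatrix Γ).Group) (hw : IsOfFinOrder w) : w * w = 1 := by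
  have key (w : (racgMatrix Γ).Group) :
      Finset.univ.toList.foldl (fun u s => racgKill Γ s u) w = 1 := by
    induction w using (racgMatrix Γ).toCoxeterSystem.simple_induction with
    | simple v => exact foldl_racgKill_simple Γ (by simp)
    | one => exact foldl_racgKill_one Γ _
    | mul w w' h h' => rw [foldl_racgKill_mul, h, h', mul_one]
  exact racg_mul_self_eq_one_of_kill Γ _ w hw (key w)
end

section
/- Let Γ be a finite simple graph with vertex set S, let a, d ∈ S be distinct vertices with St(d) ⊆ St(a), let φ be the transvection with acting letter a and domain d, and let G = W_Γ ⋊_φ (ℤ/2ℤ) with z the image in G of the generator of ℤ/2ℤ. Then (zd)² = a in G, and the element zd has order exactly 4. -/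
/-- In a right-angled Coxeter group, generators at adjacent vertices commute. -/
theorem racgMatrix_simple_commute {V : Type*} {Γ : SimpleGraph V} {s t : V} (h : Γ.Adj s t) :
    Commute ((racgMatrix Γ).simple s) ((racgMatrix Γ).simple t) := by
  have hM : racgMatrix Γ s t = 2 := by
    simp [racgMatrix, h.ne, h]
  have hst := (racgMatrix Γ).toCoxeterSystem.simple_mul_simple_pow s t
  rw [hM, sq, mul_eq_one_iff_eq_inv, mul_inv_rev, CoxeterSystem.inv_simple,
    CoxeterSystem.inv_simple] at hst
  exact hst

/-- If `φ` is the transvection of `W_Γ` with acting letter `a` and domain `d`, and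
`G = W_Γ ⋊_φ ℤ/2ℤ` with `z` the generator of the `ℤ/2ℤ` factor, then `(zd)² = a` in `G`
and `zd` has order exactly `4`. -/
theorem semidirect_by_transvection_order_four {V : Type*} [Fintype V]
    (Γ : SimpleGraph V) (a d : V) (had : a ≠ d)
    (hstar : graphStar Γ d ⊆ graphStar Γ a)
    (φ : MulAut (racgMatrix Γ).Group)
    (hφ₁ : φ ((racgMatrix Γ).simple d) = (racgMatrix Γ).simple d * (racgMatrix Γ).simple a)
    (hφ₂ : ∀ s : V, s ≠ d → φ ((racgMatrix Γ).simple s) = (racgMatrix Γ).simple s)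
    (ψ : Multiplicative (ZMod 2) →* MulAut (racgMatrix Γ).Group)
    (hψ : ψ (Multiplicative.ofAdd (1 : ZMod 2)) = φ) :
    (SemidirectProduct.inr (Multiplicative.ofAdd (1 : ZMod 2)) *
        SemidirectProduct.inl ((racgMatrix Γ).simple d) :
        (racgMatrix Γ).Group ⋊[ψ] Multiplicative (ZMod 2)) ^ 2 =
      SemidirectProduct.inl ((racgMatrix Γ).simple a) ∧
    orderOf (SemidirectProduct.inr (Multiplicative.ofAdd (1 : ZMod 2)) *
        SemidirectProduct.inl ((racgMatrix Γ).simple d) :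
        (racgMatrix Γ).Group ⋊[ψ] Multiplicative (ZMod 2)) = 4 := by
  set cs := (racgMatrix Γ).toCoxeterSystem
  have hadj : Γ.Adj a d := (hstar (Or.inl rfl)).resolve_left had.symm
  have ha : (racgMatrix Γ).simple a ≠ 1 := fun h => by
    have hlen := cs.length_simple a
    rw [← CoxeterMatrix.toCoxeterSystem_simple] at h
    rw [h, cs.length_one] at hlen
    exact zero_ne_one hlen
  have ha2 : (racgMatrix Γ).simple a ^ 2 = 1 := cs.simple_sq a
  have hsq : (SemidirectProduct.inr (Multiplicative.ofAdd (1 : ZMod 2)) *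
      SemidirectProduct.inl ((racgMatrix Γ).simple d) :
      (racgMatrix Γ).Group ⋊[ψ] Multiplicative (ZMod 2)) ^ 2 =
      SemidirectProduct.inl ((racgMatrix Γ).simple a) := by
    have hz : Multiplicative.ofAdd (1 : ZMod 2) * Multiplicative.ofAdd 1 = 1 := rfl
    have hd : (racgMatrix Γ).simple d * (racgMatrix Γ).simple d = 1 :=
      cs.simple_mul_simple_self d
    have hφφ : φ * φ = 1 := by rw [← hψ, ← map_mul, hz, map_one]
    have hφd : φ (φ ((racgMatrix Γ).simple d)) = (racgMatrix Γ).simple d :=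
      DFunLike.congr_fun hφφ _
    ext
    · simp only [sq, SemidirectProduct.mul_left, SemidirectProduct.mul_right,
        SemidirectProduct.left_inr, SemidirectProduct.right_inr, SemidirectProduct.left_inl,
        SemidirectProduct.right_inl, one_mul, mul_one, hψ, hφd]
      rw [hφ₁, mul_assoc, (racgMatrix_simple_commute hadj).eq, ← mul_assoc, hd, one_mul]
    · simp [sq, hz]
  refine ⟨hsq, orderOf_eq_prime_pow (p := 2) (n := 1) ?_ ?_⟩
  · rw [pow_one, hsq, map_eq_one_iff _ SemidirectProduct.inl_injective]
    exact ha
  · rw [pow_succ, pow_one, pow_mul, hsq, ← map_pow, ha2, map_one]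
end

section
/- Let Γ be a finite simple graph with vertex set S, let a, d ∈ S be distinct vertices with St(d) ⊆ St(a), let φ be the transvection with acting letter a and domain d, and let G = W_Γ ⋊_φ (ℤ/2ℤ) with z the image in G of the generator of ℤ/2ℤ. Let K be the subgroup of G generated by a and z. Then a and z commute and K has order 4; moreover, if a does not lie in the center of W_Γ, then the normal core of K in G (the largest normal subgroup of G contained in K) is trivial, while if a lies in the center of W_Γ, then K is normal in G, so the normal core of K in G equals K. -/
open SemidirectProduct in
/-- In `W ⋊ ℤ/2ℤ`, the subgroup generated by an involution `a` fixed by the action and by the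
generator of `ℤ/2ℤ` consists of the elements whose `W`-component is `1` or `a`. -/
theorem mem_closure_inl_inr_iff {W : Type*} [Group W]
    (ψ : Multiplicative (ZMod 2) →* MulAut W) {a : W} (ha : a * a = 1)
    (hfix : ∀ r, ψ r a = a) (x : W ⋊[ψ] Multiplicative (ZMod 2)) :
    x ∈ Subgroup.closure
      {(inl a : W ⋊[ψ] Multiplicative (ZMod 2)), inr (Multiplicative.ofAdd (1 : ZMod 2))} ↔
      x.left = 1 ∨ x.left = a := by
  constructor
  · intro hx
    induction hx using Subgroup.closure_induction with
    | mem x hx => rcases hx with rfl | rfl <;> simp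
    | one => simp
    | mul x y _ _ hx hy =>
      rcases hx with hx | hx <;> rcases hy with hy | hy <;> simp [hx, hy, hfix, ha]
    | inv x _ hx =>
      rw [inv_left]
      rcases hx with hx | hx <;> rw [hx]
      · simp
      · rw [inv_eq_of_mul_eq_one_left ha, hfix]
        exact Or.inr rfl
  · intro hx
    rw [← inl_left_mul_inr_right x]
    refine mul_mem ?_ ?_
    · rcases hx with hx | hx
      · simp [hx]
      · rw [hx]
        exact Subgroup.subset_closure (by simp)
    · have hr : ∀ r : Multiplicative (ZMod 2), r = 1 ∨ r = Multiplicative.ofAdd 1 := by decide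
      rcases hr x.right with h | h
      · simp [h]
      · rw [h]
        exact Subgroup.subset_closure (by simp)

open SemidirectProduct in
theorem card_closure_inl_inr {W : Type*} [Group W]
    (ψ : Multiplicative (ZMod 2) →* MulAut W) {a : W} (ha : a * a = 1) (ha₁ : a ≠ 1)
    (hfix : ∀ r, ψ r a = a) :
    Nat.card (Subgroup.closure
      {(inl a : W ⋊[ψ] Multiplicative (ZMod 2)),
        inr (Multiplicative.ofAdd (1 : ZMod 2))}) = 4 := by
  have e := Nat.card_congr (equivProd.subtypeEquiv (p := fun x => x ∈ Subgroup.closure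
      {(inl a : W ⋊[ψ] Multiplicative (ZMod 2)), inr (Multiplicative.ofAdd (1 : ZMod 2))})
      (q := fun y => y ∈ ({1, a} : Set W) ×ˢ (Set.univ : Set (Multiplicative (ZMod 2))))
      fun x => by simp [mem_closure_inl_inr_iff ψ ha hfix, equivProd])
  refine e.trans ?_
  change Nat.card ↥(({1, a} : Set W) ×ˢ (Set.univ : Set (Multiplicative (ZMod 2)))) = 4
  rw [Nat.card_coe_set_eq, Set.ncard_prod, Set.ncard_pair ha₁.symm, Set.ncard_univ,
    Nat.card_congr Multiplicative.toAdd, Nat.card_zmod]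

open SemidirectProduct in
/-- If `a` is not central and the generator `z` of `ℤ/2ℤ` sends some `d` commuting with `a` to
`d * a`, then `⟨a, z⟩` has trivial normal core. -/
theorem normalCore_closure_inl_inr_eq_bot {W : Type*} [Group W]
    (ψ : Multiplicative (ZMod 2) →* MulAut W) {a d : W} (ha : a * a = 1)
    (had : a * d = d * a) (hfix : ∀ r, ψ r a = a)
    (hd : ψ (Multiplicative.ofAdd 1) d = d * a) (hc : a ∉ Subgroup.center W) :
    (Subgroup.closure
      {(inl a : W ⋊[ψ] Multiplicative (ZMod 2)),
        inr (Multiplicative.ofAdd (1 : ZMod 2))}).normalCore = ⊥ := by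
  set K := Subgroup.closure
      {(inl a : W ⋊[ψ] Multiplicative (ZMod 2)), inr (Multiplicative.ofAdd (1 : ZMod 2))} with hK
  have hmem := mem_closure_inl_inr_iff ψ ha hfix
  rw [← hK] at hmem
  have ha_core : inl a ∉ K.normalCore := by
    intro h
    refine hc (Subgroup.mem_center_iff.2 fun w => ?_)
    have h₁ := (hmem _).1 (h (inl w))
    simp only [← map_mul, ← map_inv, left_inl] at h₁
    rcases h₁ with h₁ | h₁
    · have h₂ : a = 1 := by simpa using h₁
      simp [h₂]
    · exact mul_inv_eq_iff_eq_mul.1 h₁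
  have hr : ∀ r : Multiplicative (ZMod 2), r = 1 ∨ r = Multiplicative.ofAdd 1 := by decide
  rw [eq_bot_iff]
  intro x hx
  have hxK := (hmem x).1 (K.normalCore_le hx)
  rw [Subgroup.mem_bot]
  rcases hr x.right with hxr | hxr
  · rcases hxK with hxl | hxl
    · exact SemidirectProduct.ext hxl hxr
    · exact absurd ((SemidirectProduct.ext hxl hxr : x = inl a) ▸ hx) ha_core
  · refine absurd ?_ ha_core
    have hcomm : inl d⁻¹ * (x * inl d * x⁻¹) = (inl a : W ⋊[ψ] Multiplicative (ZMod 2)) := by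
      have hx' : x * inl d = inl (d * a) * x := by
        ext
        · have : x.left * d = d * x.left := by
            rcases hxK with h | h <;> simp [h, had]
          have h' : x.left * a = a * x.left := by
            rcases hxK with h | h <;> simp [h]
          simp only [mul_left, hxr, left_inl, right_inl, hd, map_one, MulAut.one_apply]
          rw [← mul_assoc, this, mul_assoc, h', mul_assoc]
        · simp
      rw [hx', mul_inv_cancel_right, ← map_mul, inv_mul_cancel_left]
    rw [← hcomm, map_inv, ← mul_assoc, ← mul_assoc]
    refine mul_mem ?_ (inv_mem hx)
    simpa using K.normalCore_normal.conj_mem x hx (inl d)⁻¹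

open SemidirectProduct in
/-- If `a` is central and the action moves every element of `W` by a power of `a`, then
`⟨a, z⟩` is normal. -/
theorem normal_closure_inl_inr {W : Type*} [Group W]
    (ψ : Multiplicative (ZMod 2) →* MulAut W) {a : W} (ha : a * a = 1)
    (hfix : ∀ r, ψ r a = a) (hc : a ∈ Subgroup.center W)
    (hmove : ∀ r w, ψ r w = w ∨ ψ r w = w * a) :
    (Subgroup.closure
      {(inl a : W ⋊[ψ] Multiplicative (ZMod 2)),
        inr (Multiplicative.ofAdd (1 : ZMod 2))}).Normal := by
  have hc' := Subgroup.mem_center_iff.1 hc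
  refine ⟨fun x hx g => ?_⟩
  rw [mem_closure_inl_inr_iff ψ ha hfix] at hx ⊢
  have hleft : (g * x * g⁻¹).left = g.left * x.left * ψ x.right g.left⁻¹ := by
    have hgx : ψ g.right x.left = x.left := by rcases hx with h | h <;> simp [h, hfix]
    have hr : g.right * x.right * g.right⁻¹ = x.right := by
      rw [mul_comm g.right, mul_inv_cancel_right]
    simp only [mul_left, mul_right, inv_left, hgx]
    rw [← MulAut.mul_apply, ← map_mul, hr]
  rw [hleft]
  rcases hx with h | h <;> rcases hmove x.right g.left⁻¹ with h' | h' <;> rw [h, h']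
  · simp
  · simp
  · simp [hc' g.left]
  · left
    rw [hc' g.left, mul_assoc, mul_inv_cancel_left, ha]

section RightAngledCoxeter

variable {V : Type*} (Γ : SimpleGraph V)

theorem racgMatrix_simple_mul_self (s : V) :
    (racgMatrix Γ).simple s * (racgMatrix Γ).simple s = 1 := by
  simpa using (racgMatrix Γ).toCoxeterSystem.simple_mul_simple_self s

theorem racgMatrix_simple_ne_one (s : V) : (racgMatrix Γ).simple s ≠ 1 := by
  intro h
  have hlift : (racgMatrix Γ).IsLiftable fun _ => (-1 : ℤˣ) := fun i j => by simp
  have key := (racgMatrix Γ).toCoxeterSystem.lift_apply_simple hlift s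
  rw [CoxeterMatrix.toCoxeterSystem_simple, h, map_one] at key
  exact absurd key (by decide)

theorem racgMatrix_simple_comm {s t : V} (h : Γ.Adj s t) :
    (racgMatrix Γ).simple s * (racgMatrix Γ).simple t =
      (racgMatrix Γ).simple t * (racgMatrix Γ).simple s := by
  have hM : racgMatrix Γ s t = 2 := by
    simp [racgMatrix, h.ne, h]
  have key := (racgMatrix Γ).toCoxeterSystem.simple_mul_simple_pow s t
  rw [hM, pow_two, CoxeterMatrix.toCoxeterSystem_simple] at key
  rw [eq_inv_of_mul_eq_one_left key, mul_inv_rev,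
    inv_eq_of_mul_eq_one_left (racgMatrix_simple_mul_self Γ s),
    inv_eq_of_mul_eq_one_left (racgMatrix_simple_mul_self Γ t)]

/-- An endomorphism moving each generator by a power of a central involution `a` moves every
element by a power of `a`. -/
theorem racgMatrix_map_eq_or_eq_mul (f : (racgMatrix Γ).Group →* (racgMatrix Γ).Group)
    {a : (racgMatrix Γ).Group} (ha : a * a = 1) (hc : a ∈ Subgroup.center (racgMatrix Γ).Group)
    (hf : ∀ s, f ((racgMatrix Γ).simple s) = (racgMatrix Γ).simple s ∨
      f ((racgMatrix Γ).simple s) = (racgMatrix Γ).simple s * a) (w : (racgMatrix Γ).Group) :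
    f w = w ∨ f w = w * a := by
  have hc' := Subgroup.mem_center_iff.1 hc
  induction w using (racgMatrix Γ).toCoxeterSystem.simple_induction with
  | simple s => simpa using hf s
  | one => simp
  | mul v w hv hw =>
    rcases hv with hv | hv <;> rcases hw with hw | hw <;> rw [map_mul, hv, hw]
    · simp
    · simp [mul_assoc]
    · right
      rw [mul_assoc, ← hc' w, mul_assoc]
    · left
      rw [mul_assoc, hc' w, ← mul_assoc a, ha, one_mul]

end RightAngledCoxeter

/-- If `φ` is the transvection of `W_Γ` with acting letter `a` and domain `d`,
`G = W_Γ ⋊_φ ℤ/2ℤ` with `z` the generator of the `ℤ/2ℤ` factor, and `K = ⟨a, z⟩ ≤ G`,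
then `a` and `z` commute and `K` has order `4`; if `a` is not central in `W_Γ` then the
normal core of `K` in `G` is trivial, and if `a` is central in `W_Γ` then `K` is normal
in `G`, so its normal core is `K` itself. -/
theorem transvection_stabilizer_subgroup {V : Type*} [Fintype V] (Γ : SimpleGraph V)
    (a d : V) (had : a ≠ d) (hstar : graphStar Γ d ⊆ graphStar Γ a)
    (φ : MulAut (racgMatrix Γ).Group)
    (hφ₁ : φ ((racgMatrix Γ).simple d) = (racgMatrix Γ).simple d * (racgMatrix Γ).simple a)
    (hφ₂ : ∀ s : V, s ≠ d → φ ((racgMatrix Γ).simple s) = (racgMatrix Γ).simple s)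
    (ψ : Multiplicative (ZMod 2) →* MulAut (racgMatrix Γ).Group)
    (hψ : ψ (Multiplicative.ofAdd (1 : ZMod 2)) = φ) :
    (SemidirectProduct.inl ((racgMatrix Γ).simple a) *
        SemidirectProduct.inr (Multiplicative.ofAdd (1 : ZMod 2)) :
        (racgMatrix Γ).Group ⋊[ψ] Multiplicative (ZMod 2)) =
      SemidirectProduct.inr (Multiplicative.ofAdd (1 : ZMod 2)) *
        SemidirectProduct.inl ((racgMatrix Γ).simple a) ∧
    Nat.card (Subgroup.closure
      {(SemidirectProduct.inl ((racgMatrix Γ).simple a) :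
          (racgMatrix Γ).Group ⋊[ψ] Multiplicative (ZMod 2)),
        SemidirectProduct.inr (Multiplicative.ofAdd (1 : ZMod 2))}) = 4 ∧
    ((racgMatrix Γ).simple a ∉ Subgroup.center (racgMatrix Γ).Group →
      (Subgroup.closure
        {(SemidirectProduct.inl ((racgMatrix Γ).simple a) :
            (racgMatrix Γ).Group ⋊[ψ] Multiplicative (ZMod 2)),
          SemidirectProduct.inr (Multiplicative.ofAdd (1 : ZMod 2))}).normalCore = ⊥) ∧
    ((racgMatrix Γ).simple a ∈ Subgroup.center (racgMatrix Γ).Group →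
      (Subgroup.closure
        {(SemidirectProduct.inl ((racgMatrix Γ).simple a) :
            (racgMatrix Γ).Group ⋊[ψ] Multiplicative (ZMod 2)),
          SemidirectProduct.inr (Multiplicative.ofAdd (1 : ZMod 2))}).Normal ∧
      (Subgroup.closure
        {(SemidirectProduct.inl ((racgMatrix Γ).simple a) :
            (racgMatrix Γ).Group ⋊[ψ] Multiplicative (ZMod 2)),
          SemidirectProduct.inr (Multiplicative.ofAdd (1 : ZMod 2))}).normalCore =
        Subgroup.closure
          {(SemidirectProduct.inl ((racgMatrix Γ).simple a) :
              (racgMatrix Γ).Group ⋊[ψ] Multiplicative (ZMod 2)),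
            SemidirectProduct.inr (Multiplicative.ofAdd (1 : ZMod 2))}) := by
  have hr : ∀ r : Multiplicative (ZMod 2), r = 1 ∨ r = Multiplicative.ofAdd 1 := by decide
  have ha := racgMatrix_simple_mul_self Γ a
  have hφa := hφ₂ a had
  have hfix : ∀ r, ψ r ((racgMatrix Γ).simple a) = (racgMatrix Γ).simple a := fun r => by
    rcases hr r with rfl | rfl
    · simp
    · rw [hψ, hφa]
  have hcomm : (racgMatrix Γ).simple a * (racgMatrix Γ).simple d =
      (racgMatrix Γ).simple d * (racgMatrix Γ).simple a :=
    racgMatrix_simple_comm Γ ((hstar (Or.inl rfl : d ∈ graphStar Γ d)).resolve_left had.symm)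
  refine ⟨?_, card_closure_inl_inr ψ ha (racgMatrix_simple_ne_one Γ a) hfix,
    normalCore_closure_inl_inr_eq_bot ψ ha hcomm hfix (by rw [hψ, hφ₁]), fun hc => ?_⟩
  · ext <;> simp [hfix]
  · have hnormal := normal_closure_inl_inr ψ ha hfix hc fun r w => by
      rcases hr r with rfl | rfl
      · simp
      · rw [hψ]
        refine racgMatrix_map_eq_or_eq_mul Γ φ.toMonoidHom ha hc (fun s => ?_) w
        by_cases hs : s = d
        · subst hs
          exact Or.inr hφ₁
        · exact Or.inl (hφ₂ s hs)
    exact ⟨hnormal, Subgroup.normalCore_eq_self _⟩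
end
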